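/- Let d ≥ 1, a > 0, L > 0, R ≥ 1, η > 0 and τ > 0. Let K ⊆ ℝ^d be closed and convex with B(0,1) ⊆ K ⊆ B(0,R), and let f : ℝ^d → ℝ be convex on K and L-Lipschitz on K. Let Q = {(x,t) ∈ ℝ^d × ℝ : x ∈ K, f(x) ≤ a t}, set Z_Q = ∫_Q e^{-a t} dx dt and C_L = √(a² + L²) + L R + d. Then ∫_{ℝ^{d+1}} e^{-a t} · exp(−(dist(w, Q) − τ)²/(2η)) dw ≤ Z_Q · e^{τ C_L} · [ C_L·√(2πη)·e^{η C_L²/2} + 1 ], where w = (x,t) ranges over ℝ^{d+1} and t is the last coordinate of w. -/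

import Mathlib

open MeasureTheory

/-- The Euclidean norm of a point of `ℝ^d × ℝ ≅ ℝ^{d+1}`. -/
noncomputable def enorm2 {d : ℕ} (p : EuclideanSpace ℝ (Fin d) × ℝ) : ℝ :=
  Real.sqrt (‖p.1‖ ^ 2 + p.2 ^ 2)

/-- The Euclidean distance from a point of `ℝ^{d+1}` to a set. -/
noncomputable def edist2 {d : ℕ} (w : EuclideanSpace ℝ (Fin d) × ℝ)
    (Q : Set (EuclideanSpace ℝ (Fin d) × ℝ)) : ℝ :=
  sInf ((fun q => enorm2 (w - q)) '' Q)

/-- An unnormalised Gaussian bump centred at `τ` with variance `η`, tilted by `exp (C * s)`. -/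
noncomputable def tiltedGaussian (C τ η s : ℝ) : ℝ :=
  Real.exp (C * s - (s - τ) ^ 2 / (2 * η))

theorem continuous_tiltedGaussian (C τ η : ℝ) : Continuous (tiltedGaussian C τ η) := by
  unfold tiltedGaussian
  fun_prop

theorem tiltedGaussian_pos (C τ η s : ℝ) : 0 < tiltedGaussian C τ η s :=
  Real.exp_pos _

theorem tiltedGaussian_eq (C τ : ℝ) {η : ℝ} (hη : 0 < η) (s : ℝ) :
    tiltedGaussian C τ η s =
      Real.exp (τ * C + η * C ^ 2 / 2) *
        Real.exp (-(1 / (2 * η)) * (s - (τ + η * C)) ^ 2) := by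
  rw [tiltedGaussian, ← Real.exp_add]
  congr 1
  field_simp
  ring

theorem integrable_tiltedGaussian (C τ : ℝ) {η : ℝ} (hη : 0 < η) :
    Integrable (tiltedGaussian C τ η) := by
  have h := ((integrable_exp_neg_mul_sq (b := 1 / (2 * η)) (by positivity)).comp_sub_right
    (τ + η * C)).const_mul (Real.exp (τ * C + η * C ^ 2 / 2))
  exact h.congr (.of_forall fun s => (tiltedGaussian_eq C τ hη s).symm)

theorem integral_tiltedGaussian (C τ : ℝ) {η : ℝ} (hη : 0 < η) :
    ∫ s, tiltedGaussian C τ η s =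
      Real.exp (τ * C + η * C ^ 2 / 2) * Real.sqrt (2 * Real.pi * η) := by
  simp_rw [tiltedGaussian_eq C τ hη]
  rw [integral_const_mul,
    integral_sub_right_eq_self (fun s => Real.exp (-(1 / (2 * η)) * s ^ 2)), integral_gaussian]
  congr 2
  field_simp

theorem integrable_mul_tiltedGaussian (C τ : ℝ) {η : ℝ} (hη : 0 < η) :
    Integrable fun s => (s - τ) / η * tiltedGaussian C τ η s := by
  have h := ((integrable_mul_exp_neg_mul_sq (b := 1 / (2 * η)) (by positivity)).comp_sub_right
    (τ + η * C)).const_mul (Real.exp (τ * C + η * C ^ 2 / 2) / η)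
  refine (h.add ((integrable_tiltedGaussian C τ hη).const_mul C)).congr (.of_forall fun s => ?_)
  simp only [Pi.add_apply, tiltedGaussian_eq C τ hη]
  field_simp
  ring

theorem hasDerivAt_tiltedGaussian (C τ : ℝ) {η : ℝ} (hη : 0 < η) (s : ℝ) :
    HasDerivAt (tiltedGaussian C τ η)
      (C * tiltedGaussian C τ η s - (s - τ) / η * tiltedGaussian C τ η s) s := by
  have h := (((hasDerivAt_id s).const_mul C).sub
    ((((hasDerivAt_id s).sub_const τ).pow 2).div_const (2 * η))).exp
  refine h.congr_deriv ?_
  simp only [tiltedGaussian, id, Pi.sub_apply, Pi.pow_apply]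
  field_simp
  norm_num
  ring

/-- Integration by parts on a half line. -/
theorem setIntegral_Ioi_mul_tiltedGaussian (C τ : ℝ) {η : ℝ} (hη : 0 < η) (m : ℝ) :
    ∫ s in Set.Ioi m, (s - τ) / η * tiltedGaussian C τ η s =
      tiltedGaussian C τ η m + C * ∫ s in Set.Ioi m, tiltedGaussian C τ η s := by
  have hi := (integrable_tiltedGaussian C τ hη).integrableOn (s := Set.Ioi m)
  have hi' := (integrable_mul_tiltedGaussian C τ hη).integrableOn (s := Set.Ioi m)
  have hd : IntegrableOn (fun s => C * tiltedGaussian C τ η s -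
      (s - τ) / η * tiltedGaussian C τ η s) (Set.Ioi m) := (hi.const_mul C).sub hi'
  have hlim := tendsto_zero_of_hasDerivAt_of_integrableOn_Ioi
    (fun s _ => hasDerivAt_tiltedGaussian C τ hη s) hd hi
  have h := integral_Ioi_of_hasDerivAt_of_tendsto'
    (fun s _ => hasDerivAt_tiltedGaussian C τ hη s) hd hlim
  rw [integral_sub (hi.const_mul C) hi', integral_const_mul] at h
  linarith

theorem setLIntegral_Ioi_mul_tiltedGaussian (C : ℝ) {τ η m : ℝ} (hη : 0 < η) (hm : τ ≤ m) :
    ∫⁻ s in Set.Ioi m, ENNReal.ofReal ((s - τ) / η * tiltedGaussian C τ η s) =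
      ENNReal.ofReal
        (tiltedGaussian C τ η m + C * ∫ s in Set.Ioi m, tiltedGaussian C τ η s) := by
  rw [← setIntegral_Ioi_mul_tiltedGaussian C τ hη,
    ofReal_integral_eq_lintegral_ofReal (integrable_mul_tiltedGaussian C τ hη).integrableOn]
  filter_upwards [ae_restrict_mem measurableSet_Ioi] with s hs
  have : 0 ≤ s - τ := by linarith [Set.mem_Ioi.1 hs]
  have := (tiltedGaussian_pos C τ η s).le
  simp only [Pi.zero_apply]
  positivity

/-- If the weighted measure of the sublevel sets `{D < s}` grows at most like `exp (C * s)`, then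
the integral of a Gaussian bump in `D` is controlled. -/
theorem lintegral_gaussian_comp_le {α : Type*} [MeasurableSpace α] {μ : Measure α} [SFinite μ]
    {D : α → ℝ} (hD : Measurable D) {F : α → ENNReal} (hF : Measurable F) {Z : ENNReal}
    {C τ η : ℝ} (hC : 0 ≤ C) (hη : 0 < η)
    (hgrowth : ∀ s, τ < s → ∫⁻ w in {w | D w < s}, F w ∂μ ≤ Z * ENNReal.ofReal (Real.exp (C * s))) :
    ∫⁻ w, F w * ENNReal.ofReal (Real.exp (-(D w - τ) ^ 2 / (2 * η))) ∂μ ≤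
      Z * ENNReal.ofReal (Real.exp (τ * C) *
        (C * Real.sqrt (2 * Real.pi * η) * Real.exp (η * C ^ 2 / 2) + 1)) := by
  let φ : ℝ → ENNReal := fun s => ENNReal.ofReal ((s - τ) / η * tiltedGaussian 0 τ η s)
  have hφ : Measurable φ := by
    have := (continuous_tiltedGaussian 0 τ η).measurable
    fun_prop
  have hlt : MeasurableSet {p : α × ℝ | D p.1 < p.2} :=
    measurableSet_lt (hD.comp measurable_fst) measurable_snd
  have hbump : ∀ r : ℝ, ENNReal.ofReal (Real.exp (-(r - τ) ^ 2 / (2 * η))) ≤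
      ∫⁻ s in Set.Ioi τ, (Set.Ioi r).indicator φ s := by
    intro r
    rw [setLIntegral_indicator measurableSet_Ioi, Set.Ioi_inter_Ioi,
      setLIntegral_Ioi_mul_tiltedGaussian 0 hη le_sup_right]
    apply ENNReal.ofReal_le_ofReal
    simp only [tiltedGaussian, zero_mul, add_zero, zero_sub, ← neg_div]
    apply Real.exp_le_exp.2
    gcongr ?_ / _
    rcases le_total r τ with h | h
    · simp only [sup_of_le_right h, sub_self]
      nlinarith [sq_nonneg (r - τ)]
    · simp [sup_of_le_left h]
  calc ∫⁻ w, F w * ENNReal.ofReal (Real.exp (-(D w - τ) ^ 2 / (2 * η))) ∂μ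
      ≤ ∫⁻ w, F w * (∫⁻ s in Set.Ioi τ, (Set.Ioi (D w)).indicator φ s) ∂μ := by
        gcongr
        exact hbump _
    _ = ∫⁻ w, (∫⁻ s in Set.Ioi τ,
          {p : α × ℝ | D p.1 < p.2}.indicator (fun p => F p.1 * φ p.2) (w, s)) ∂μ := by
        refine lintegral_congr fun w => ?_
        rw [← lintegral_const_mul _ (hφ.indicator measurableSet_Ioi)]
        refine lintegral_congr fun s => ?_
        by_cases h : D w < s <;> simp [Set.indicator, h]
    _ = ∫⁻ s in Set.Ioi τ, ∫⁻ w,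
          {p : α × ℝ | D p.1 < p.2}.indicator (fun p => F p.1 * φ p.2) (w, s) ∂μ := by
        apply lintegral_lintegral_swap
        refine Measurable.aemeasurable (Measurable.indicator ?_ hlt)
        fun_prop
    _ = ∫⁻ s in Set.Ioi τ, φ s * ∫⁻ w in {w | D w < s}, F w ∂μ := by
        refine lintegral_congr fun s => ?_
        have hs : MeasurableSet {w | D w < s} := measurableSet_lt hD measurable_const
        rw [← lintegral_indicator hs, ← lintegral_const_mul _ (hF.indicator hs)]
        refine lintegral_congr fun w => ?_
        by_cases h : D w < s <;> simp [Set.indicator, h, mul_comm]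
    _ ≤ ∫⁻ s in Set.Ioi τ, Z * ENNReal.ofReal ((s - τ) / η * tiltedGaussian C τ η s) := by
        refine setLIntegral_mono' measurableSet_Ioi fun s hs => ?_
        have hs' : 0 ≤ (s - τ) / η := div_nonneg (sub_nonneg.2 (le_of_lt hs)) hη.le
        calc φ s * ∫⁻ w in {w | D w < s}, F w ∂μ
            ≤ φ s * (Z * ENNReal.ofReal (Real.exp (C * s))) := by
              gcongr
              exact hgrowth s hs
          _ = Z * ENNReal.ofReal ((s - τ) / η * tiltedGaussian C τ η s) := by
              rw [mul_left_comm, ← ENNReal.ofReal_mul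
                (mul_nonneg hs' (tiltedGaussian_pos 0 τ η s).le), mul_assoc]
              congr 3
              rw [tiltedGaussian, tiltedGaussian, ← Real.exp_add]
              congr 1
              ring
    _ = Z * ENNReal.ofReal (tiltedGaussian C τ η τ +
          C * ∫ s in Set.Ioi τ, tiltedGaussian C τ η s) := by
        have := (continuous_tiltedGaussian C τ η).measurable
        rw [lintegral_const_mul _ (by fun_prop), setLIntegral_Ioi_mul_tiltedGaussian C hη le_rfl]
    _ ≤ _ := by
        gcongr
        have h := setIntegral_le_integral (s := Set.Ioi τ) (integrable_tiltedGaussian C τ hη)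
          (.of_forall fun s => (tiltedGaussian_pos C τ η s).le)
        rw [integral_tiltedGaussian C τ hη, Real.exp_add] at h
        have h' := mul_le_mul_of_nonneg_left h hC
        have h0 : tiltedGaussian C τ η τ = Real.exp (τ * C) := by
          simp [tiltedGaussian, mul_comm]
        rw [h0]
        linarith

/-- Scaling the first factor by `c` and translating the second one changes the Lebesgue integral by
the factor `c ^ d`. -/
theorem lintegral_prod_smul_add {d : ℕ} {c : ℝ} (hc : 0 < c) (b : ℝ)
    {F : EuclideanSpace ℝ (Fin d) × ℝ → ENNReal} (hF : Measurable F) :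
    ∫⁻ w : EuclideanSpace ℝ (Fin d) × ℝ, F (c⁻¹ • w.1, w.2 + b) =
      ENNReal.ofReal (c ^ d) * ∫⁻ w, F w := by
  have hmeas : Measurable fun w : EuclideanSpace ℝ (Fin d) × ℝ => F (c⁻¹ • w.1, w.2 + b) := by
    fun_prop
  rw [Measure.volume_eq_prod, lintegral_prod _ hmeas.aemeasurable,
    lintegral_prod _ hF.aemeasurable]
  have hinner : ∀ x : EuclideanSpace ℝ (Fin d),
      ∫⁻ t, F (c⁻¹ • x, t + b) = ∫⁻ t, F (c⁻¹ • x, t) := fun x =>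
    lintegral_add_right_eq_self (fun t => F (c⁻¹ • x, t)) b
  simp_rw [hinner]
  have hG : Measurable fun x : EuclideanSpace ℝ (Fin d) => ∫⁻ t, F (x, t) :=
    hF.lintegral_prod_right'
  rw [← lintegral_map (g := fun x : EuclideanSpace ℝ (Fin d) => c⁻¹ • x) hG (by fun_prop),
    Measure.map_addHaar_smul _ (inv_ne_zero hc.ne'), lintegral_smul_measure, smul_eq_mul]
  simp [abs_of_pos hc]

theorem continuous_enorm2 {d : ℕ} : Continuous (enorm2 (d := d)) := by
  unfold enorm2
  fun_prop

theorem edist2_lt_iff {d : ℕ} {Q : Set (EuclideanSpace ℝ (Fin d) × ℝ)} (hQ : Q.Nonempty)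
    {w : EuclideanSpace ℝ (Fin d) × ℝ} {s : ℝ} :
    edist2 w Q < s ↔ ∃ q ∈ Q, enorm2 (w - q) < s := by
  rw [edist2, csInf_lt_iff ⟨0, ?_⟩ (hQ.image _)]
  · simp
  · rintro _ ⟨q, -, rfl⟩
    exact Real.sqrt_nonneg _

theorem measurable_edist2 {d : ℕ} {Q : Set (EuclideanSpace ℝ (Fin d) × ℝ)} (hQ : Q.Nonempty) :
    Measurable fun w => edist2 w Q := by
  refine measurable_of_Iio fun s => IsOpen.measurableSet ?_
  have : (fun w => edist2 w Q) ⁻¹' Set.Iio s = ⋃ q ∈ Q, {w | enorm2 (w - q) < s} := by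
    ext w
    simp [edist2_lt_iff hQ]
  rw [this]
  exact isOpen_biUnion fun q _ =>
    isOpen_lt (continuous_enorm2.comp (continuous_id.sub continuous_const)) continuous_const

theorem norm_fst_le_enorm2 {d : ℕ} (p : EuclideanSpace ℝ (Fin d) × ℝ) : ‖p.1‖ ≤ enorm2 p :=
  Real.le_sqrt_of_sq_le (by nlinarith [sq_nonneg p.2])

theorem mul_add_mul_abs_le_mul_enorm2 {d : ℕ} (a L : ℝ) (p : EuclideanSpace ℝ (Fin d) × ℝ) :
    L * ‖p.1‖ + a * |p.2| ≤ Real.sqrt (a ^ 2 + L ^ 2) * enorm2 p := by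
  rw [enorm2, ← Real.sqrt_mul (by positivity)]
  apply Real.le_sqrt_of_sq_le
  nlinarith [sq_nonneg (a * ‖p.1‖ - L * |p.2|), sq_abs p.2]

/-- Points within distance `s` of the epigraph are mapped back into it by shrinking the first
coordinate by `1 + s` and raising the last one. -/
theorem shrink_mem_epigraph {d : ℕ} {a L R s : ℝ} (ha : 0 < a) (hL : 0 < L) (hs : 0 < s)
    {K : Set (EuclideanSpace ℝ (Fin d))} (hKconv : Convex ℝ K)
    (hK1 : Metric.closedBall (0 : EuclideanSpace ℝ (Fin d)) 1 ⊆ K)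
    (hKR : K ⊆ Metric.closedBall (0 : EuclideanSpace ℝ (Fin d)) R)
    {f : EuclideanSpace ℝ (Fin d) → ℝ}
    (hfL : ∀ u ∈ K, ∀ v ∈ K, |f u - f v| ≤ L * ‖u - v‖)
    {w q : EuclideanSpace ℝ (Fin d) × ℝ} (hq : q.1 ∈ K ∧ f q.1 ≤ a * q.2)
    (hwq : enorm2 (w - q) < s) :
    (1 + s)⁻¹ • w.1 ∈ K ∧ f ((1 + s)⁻¹ • w.1) ≤
      a * (w.2 + s * (Real.sqrt (a ^ 2 + L ^ 2) + L * R) / a) := by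
  have hs1 : 0 < 1 + s := by linarith
  have hu : s⁻¹ • (w.1 - q.1) ∈ K := by
    apply hK1
    rw [mem_closedBall_zero_iff, norm_smul, norm_inv, Real.norm_of_nonneg hs.le,
      inv_mul_le_one₀ hs]
    exact ((norm_fst_le_enorm2 (w - q)).trans_lt hwq).le
  have hmem : (1 + s)⁻¹ • w.1 ∈ K := by
    have h := hKconv hq.1 hu (a := (1 + s)⁻¹) (b := (1 + s)⁻¹ * s) (by positivity) (by positivity)
      (by field_simp)
    rwa [mul_smul, smul_inv_smul₀ hs.ne', ← smul_add, add_sub_cancel] at h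
  refine ⟨hmem, ?_⟩
  set x := (1 + s)⁻¹ • w.1 with hx
  have hwx : w.1 = (1 + s) • x := by rw [hx, smul_inv_smul₀ hs1.ne']
  have hxR : ‖x‖ ≤ R := mem_closedBall_zero_iff.1 (hKR hmem)
  have hdist : ‖x - q.1‖ ≤ s * R + ‖w.1 - q.1‖ := by
    have : x - q.1 = (w.1 - q.1) - s • x := by
      rw [hwx, add_smul, one_smul]
      abel
    rw [this]
    refine (norm_sub_le _ _).trans ?_
    rw [norm_smul, Real.norm_of_nonneg hs.le]
    nlinarith
  have hf := (abs_le.1 (hfL x hmem q.1 hq.1)).2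
  have hcs := mul_add_mul_abs_le_mul_enorm2 a L (w - q)
  have hle : Real.sqrt (a ^ 2 + L ^ 2) * enorm2 (w - q) ≤ Real.sqrt (a ^ 2 + L ^ 2) * s := by
    gcongr
  have ht : a * (q.2 - w.2) ≤ a * |w.2 - q.2| := by
    gcongr
    rw [abs_sub_comm]
    exact le_abs_self _
  have hLd : L * ‖x - q.1‖ ≤ L * (s * R + ‖w.1 - q.1‖) := by gcongr
  rw [mul_add, mul_div_cancel₀ _ ha.ne']
  simp only [Prod.fst_sub, Prod.snd_sub] at hcs
  linarith [hq.2]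

theorem isClosed_epigraph {d : ℕ} {a L : ℝ} (hL : 0 < L)
    {K : Set (EuclideanSpace ℝ (Fin d))} (hKcl : IsClosed K)
    {f : EuclideanSpace ℝ (Fin d) → ℝ}
    (hfL : ∀ u ∈ K, ∀ v ∈ K, |f u - f v| ≤ L * ‖u - v‖) :
    IsClosed {q : EuclideanSpace ℝ (Fin d) × ℝ | q.1 ∈ K ∧ f q.1 ≤ a * q.2} := by
  have hf : ContinuousOn f K := by
    refine (LipschitzOnWith.of_dist_le_mul (K := ⟨L, hL.le⟩) fun u hu v hv => ?_).continuousOn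
    rw [Real.dist_eq, dist_eq_norm]
    exact hfL u hu v hv
  exact (hKcl.preimage continuous_fst).isClosed_le
    (hf.comp continuousOn_fst fun _ h => h) (by fun_prop)

/-- The exponential volume of the `s`-neighbourhood of the epigraph grows at most exponentially
in `s`. -/
theorem setLIntegral_edist2_lt_le {d : ℕ} {a L R s : ℝ} (ha : 0 < a) (hL : 0 < L) (hs : 0 < s)
    {K : Set (EuclideanSpace ℝ (Fin d))} (hKcl : IsClosed K) (hKconv : Convex ℝ K)
    (hK1 : Metric.closedBall (0 : EuclideanSpace ℝ (Fin d)) 1 ⊆ K)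
    (hKR : K ⊆ Metric.closedBall (0 : EuclideanSpace ℝ (Fin d)) R)
    {f : EuclideanSpace ℝ (Fin d) → ℝ}
    (hfL : ∀ u ∈ K, ∀ v ∈ K, |f u - f v| ≤ L * ‖u - v‖)
    {Q : Set (EuclideanSpace ℝ (Fin d) × ℝ)} (hQ : Q = {q | q.1 ∈ K ∧ f q.1 ≤ a * q.2})
    (hQne : Q.Nonempty) :
    ∫⁻ w in {w | edist2 w Q < s}, ENNReal.ofReal (Real.exp (-a * w.2)) ≤
      (∫⁻ w in Q, ENNReal.ofReal (Real.exp (-a * w.2))) *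
        ENNReal.ofReal (Real.exp ((Real.sqrt (a ^ 2 + L ^ 2) + L * R + d) * s)) := by
  have hs1 : 0 < 1 + s := by linarith
  have hQm : MeasurableSet Q := hQ ▸ (isClosed_epigraph hL hKcl hfL).measurableSet
  set B := s * (Real.sqrt (a ^ 2 + L ^ 2) + L * R) with hB
  let E : EuclideanSpace ℝ (Fin d) × ℝ → ENNReal := fun w => ENNReal.ofReal (Real.exp (-a * w.2))
  have hE : Measurable E := by fun_prop
  have hEB : ∀ w : EuclideanSpace ℝ (Fin d) × ℝ,
      E w = ENNReal.ofReal (Real.exp B) * E ((1 + s)⁻¹ • w.1, w.2 + B / a) := by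
    intro w
    rw [← ENNReal.ofReal_mul (Real.exp_pos _).le, ← Real.exp_add]
    simp only [E]
    congr 2
    field_simp
    ring
  calc ∫⁻ w in {w | edist2 w Q < s}, E w
      = ∫⁻ w, {w | edist2 w Q < s}.indicator E w :=
        (lintegral_indicator (measurableSet_lt (measurable_edist2 hQne) measurable_const) _).symm
    _ ≤ ∫⁻ w : EuclideanSpace ℝ (Fin d) × ℝ,
          ENNReal.ofReal (Real.exp B) * Q.indicator E ((1 + s)⁻¹ • w.1, w.2 + B / a) := by
        refine lintegral_mono (Set.indicator_le fun w hw => ?_)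
        obtain ⟨q, hq, hwq⟩ := (edist2_lt_iff hQne).1 hw
        rw [hQ] at hq
        have hmem : ((1 + s)⁻¹ • w.1, w.2 + B / a) ∈ Q :=
          hQ ▸ shrink_mem_epigraph ha hL hs hKconv hK1 hKR hfL hq hwq
        rw [Set.indicator_of_mem hmem]
        exact (hEB w).le
    _ = ENNReal.ofReal (Real.exp B) * (ENNReal.ofReal ((1 + s) ^ d) * ∫⁻ w in Q, E w) := by
        have hI := hE.indicator hQm
        rw [lintegral_const_mul _ (by fun_prop), lintegral_prod_smul_add hs1 _ hI,
          lintegral_indicator hQm]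
    _ = (∫⁻ w in Q, E w) * ENNReal.ofReal (Real.exp B * (1 + s) ^ d) := by
        rw [ENNReal.ofReal_mul (Real.exp_pos _).le]
        ring
    _ ≤ _ := by
        gcongr
        calc Real.exp B * (1 + s) ^ d ≤ Real.exp B * Real.exp s ^ d := by
              gcongr
              linarith [Real.add_one_le_exp s]
          _ = _ := by
              rw [← Real.exp_nat_mul, ← Real.exp_add, hB]
              congr 1
              ring

/-- Key technical estimate (constrained case): for `Q = {(x,t) : x ∈ K, f x ≤ a t}` with
`B(0,1) ⊆ K ⊆ B(0,R)`, `f` convex and `L`-Lipschitz on `K`, `C_L = √(a²+L²) + LR + d`, and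
any `τ > 0`,
`∫_{ℝ^{d+1}} e^{-at} exp(-(dist(w,Q)-τ)²/(2η)) dw ≤ Z_Q e^{τC_L} (C_L √(2πη) e^{ηC_L²/2} + 1)`. -/
theorem stmt_15 {d : ℕ} (hd : 1 ≤ d) (a L R η τ : ℝ) (ha : 0 < a) (hL : 0 < L) (hR : 1 ≤ R)
    (hη : 0 < η) (hτ : 0 < τ)
    (K : Set (EuclideanSpace ℝ (Fin d))) (hKcl : IsClosed K) (hKconv : Convex ℝ K)
    (hK1 : Metric.closedBall (0 : EuclideanSpace ℝ (Fin d)) 1 ⊆ K)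
    (hKR : K ⊆ Metric.closedBall (0 : EuclideanSpace ℝ (Fin d)) R)
    (f : EuclideanSpace ℝ (Fin d) → ℝ) (hfc : ConvexOn ℝ K f)
    (hfL : ∀ u ∈ K, ∀ v ∈ K, |f u - f v| ≤ L * ‖u - v‖) :
    ∫⁻ w : EuclideanSpace ℝ (Fin d) × ℝ,
      ENNReal.ofReal (Real.exp (-a * w.2) *
        Real.exp (-(edist2 w {q : EuclideanSpace ℝ (Fin d) × ℝ |
            q.1 ∈ K ∧ f q.1 ≤ a * q.2} - τ) ^ 2 / (2 * η)))
    ≤ (∫⁻ w in {w : EuclideanSpace ℝ (Fin d) × ℝ | w.1 ∈ K ∧ f w.1 ≤ a * w.2},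
          ENNReal.ofReal (Real.exp (-a * w.2)))
      * ENNReal.ofReal (Real.exp (τ * (Real.sqrt (a ^ 2 + L ^ 2) + L * R + d)) *
          ((Real.sqrt (a ^ 2 + L ^ 2) + L * R + d) * Real.sqrt (2 * Real.pi * η)
              * Real.exp (η * (Real.sqrt (a ^ 2 + L ^ 2) + L * R + d) ^ 2 / 2) + 1)) := by
  set Q := {q : EuclideanSpace ℝ (Fin d) × ℝ | q.1 ∈ K ∧ f q.1 ≤ a * q.2} with hQ
  have hQne : Q.Nonempty := by
    refine ⟨(0, f 0 / a), hK1 (by simp), ?_⟩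
    rw [mul_div_cancel₀ _ ha.ne']
  simp_rw [ENNReal.ofReal_mul (Real.exp_pos (-a * _)).le]
  exact lintegral_gaussian_comp_le (measurable_edist2 hQne) (by fun_prop) (by positivity) hη
    fun s hs => setLIntegral_edist2_lt_le ha hL (hτ.trans hs) hKcl hKconv hK1 hKR hfL hQ hQne
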